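/- For every fixed integer k ≥ 3 there exist a constant c > 0 and an integer n₀ such that for every n ≥ n₀ with k·n even, the number of distinct values taken by τ(G), as G ranges over all connected k-regular simple graphs on n vertices, is at least 2^{c·n}. -/

import Mathlib

/-- The number of spanning trees of a finite simple graph `G`: the number of
subgraphs `T ≤ G` (on the same vertex set) that are trees. -/
noncomputable def numSpanningTrees {V : Type} [Fintype V] (G : SimpleGraph V) : ℕ :=
  Set.ncard {T : SimpleGraph V | T ≤ G ∧ T.IsTree}

section TreesOfJoins

variable {V W : Type}

/-- The disjoint union of `A` and `B` together with the edge joining `u` to `w`. -/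
def bridgeSum (A : SimpleGraph V) (B : SimpleGraph W) (u : V) (w : W) : SimpleGraph (V ⊕ W) :=
  (A ⊕g B) ⊔ SimpleGraph.edge (Sum.inl u) (Sum.inr w)

/-- The disjoint union of `A` and `B` together with the edges joining `u` to `w` and `v` to `x`. -/
def doubleBridgeSum (A : SimpleGraph V) (B : SimpleGraph W) (u v : V) (w x : W) :
    SimpleGraph (V ⊕ W) :=
  bridgeSum A B u w ⊔ SimpleGraph.edge (Sum.inl v) (Sum.inr x)

variable {A A' : SimpleGraph V} {B B' : SimpleGraph W} {u v : V} {w x : W}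

@[simp] lemma bridgeSum_adj_inl_inl {a b : V} :
    (bridgeSum A B u w).Adj (.inl a) (.inl b) ↔ A.Adj a b := by
  simp [bridgeSum, SimpleGraph.edge_adj]

@[simp] lemma bridgeSum_adj_inr_inr {a b : W} :
    (bridgeSum A B u w).Adj (.inr a) (.inr b) ↔ B.Adj a b := by
  simp [bridgeSum, SimpleGraph.edge_adj]

@[simp] lemma bridgeSum_adj_inl_inr {a : V} {b : W} :
    (bridgeSum A B u w).Adj (.inl a) (.inr b) ↔ a = u ∧ b = w := by
  simp [bridgeSum, SimpleGraph.edge_adj]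

@[simp] lemma bridgeSum_adj_inr_inl {a : V} {b : W} :
    (bridgeSum A B u w).Adj (.inr b) (.inl a) ↔ a = u ∧ b = w := by
  rw [SimpleGraph.adj_comm, bridgeSum_adj_inl_inr]

@[simp] lemma doubleBridgeSum_adj_inl_inl {a b : V} :
    (doubleBridgeSum A B u v w x).Adj (.inl a) (.inl b) ↔ A.Adj a b := by
  simp [doubleBridgeSum, SimpleGraph.edge_adj]

@[simp] lemma doubleBridgeSum_adj_inr_inr {a b : W} :
    (doubleBridgeSum A B u v w x).Adj (.inr a) (.inr b) ↔ B.Adj a b := by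
  simp [doubleBridgeSum, SimpleGraph.edge_adj]

@[simp] lemma doubleBridgeSum_adj_inl_inr {a : V} {b : W} :
    (doubleBridgeSum A B u v w x).Adj (.inl a) (.inr b) ↔ a = u ∧ b = w ∨ a = v ∧ b = x := by
  simp [doubleBridgeSum, SimpleGraph.edge_adj]

@[simp] lemma doubleBridgeSum_adj_inr_inl {a : V} {b : W} :
    (doubleBridgeSum A B u v w x).Adj (.inr b) (.inl a) ↔ a = u ∧ b = w ∨ a = v ∧ b = x := by
  rw [SimpleGraph.adj_comm, doubleBridgeSum_adj_inl_inr]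

lemma SimpleGraph.Reachable.mem_of_closed {G : SimpleGraph V} {s : Set V} {a b : V}
    (h : G.Reachable a b) (hs : ∀ a b, G.Adj a b → a ∈ s → b ∈ s) (ha : a ∈ s) : b ∈ s := by
  obtain ⟨p⟩ := h
  induction p with
  | nil => exact ha
  | cons hadj _ ih => exact ih (hs _ _ hadj ha)

lemma isAcyclic_sum : (A ⊕g B).IsAcyclic ↔ A.IsAcyclic ∧ B.IsAcyclic := by
  refine ⟨fun h ↦ ⟨h.embedding SimpleGraph.Embedding.sumInl,
    h.embedding SimpleGraph.Embedding.sumInr⟩, fun ⟨hA, hB⟩ ↦ ?_⟩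
  rw [SimpleGraph.isAcyclic_iff_forall_adj_isBridge] at *
  rintro (a | a) (b | b) hab
  · have := hA (SimpleGraph.sum_adj_inl.1 hab)
    rw [SimpleGraph.isBridge_iff] at this ⊢
    intro h
    have := h.mem_of_closed
      (s := {z | ∃ c, z = Sum.inl c ∧ (A.deleteEdges {s(a, b)}).Reachable a c}) ?_ ⟨a, rfl, .rfl⟩
    · grind
    · rintro (c | c) (d | d) hcd ⟨e, he, hr⟩
      · cases he
        exact ⟨d, rfl, hr.trans (SimpleGraph.Adj.reachable (by simpa using hcd))⟩
      all_goals simp at he hcd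
  · simp at hab
  · simp at hab
  · have := hB (SimpleGraph.sum_adj_inr.1 hab)
    rw [SimpleGraph.isBridge_iff] at this ⊢
    intro h
    have := h.mem_of_closed
      (s := {z | ∃ c, z = Sum.inr c ∧ (B.deleteEdges {s(a, b)}).Reachable a c}) ?_ ⟨a, rfl, .rfl⟩
    · grind
    · rintro (c | c) (d | d) hcd ⟨e, he, hr⟩
      · simp at he
      · simp at he
      · simp at hcd
      · cases he
        exact ⟨d, rfl, hr.trans (SimpleGraph.Adj.reachable (by simpa using hcd))⟩

lemma isAcyclic_bridgeSum : (bridgeSum A B u w).IsAcyclic ↔ A.IsAcyclic ∧ B.IsAcyclic := by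
  rw [bridgeSum, SimpleGraph.isAcyclic_add_edge_iff_of_not_reachable _ _
    (SimpleGraph.not_reachable_sum_inl_inr _ _), isAcyclic_sum]

lemma SimpleGraph.Reachable.bridgeSum_inl {a b : V} (h : A.Reachable a b) :
    (bridgeSum A B u w).Reachable (.inl a) (.inl b) :=
  h.map (⟨Sum.inl, by simp⟩ : A →g bridgeSum A B u w)

lemma SimpleGraph.Reachable.bridgeSum_inr {a b : W} (h : B.Reachable a b) :
    (bridgeSum A B u w).Reachable (.inr a) (.inr b) :=
  h.map (⟨Sum.inr, by simp⟩ : B →g bridgeSum A B u w)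

lemma bridgeSum_reachable_inl_iff {a : V} {z : V ⊕ W} :
    (bridgeSum A B u w).Reachable (.inl a) z ↔
      z.elim (fun b ↦ A.Reachable a b) (fun c ↦ A.Reachable a u ∧ B.Reachable w c) := by
  constructor
  · intro h
    refine h.mem_of_closed (s := {z : V ⊕ W | z.elim (fun b ↦ A.Reachable a b)
      (fun c ↦ A.Reachable a u ∧ B.Reachable w c)}) ?_ (.refl a)
    rintro (c | c) (d | d) hcd hc <;> simp at hcd hc ⊢
    · exact hc.trans hcd.reachable
    · exact ⟨hcd.1 ▸ hc, hcd.2 ▸ .rfl⟩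
    · exact hcd.1 ▸ hc.1
    · exact ⟨hc.1, hc.2.trans hcd.reachable⟩
  · rcases z with b | c
    · exact fun h ↦ h.bridgeSum_inl
    · rintro ⟨h1, h2⟩
      exact h1.bridgeSum_inl.trans (.trans (SimpleGraph.Adj.reachable (by simp)) h2.bridgeSum_inr)

lemma isTree_bridgeSum : (bridgeSum A B u w).IsTree ↔ A.IsTree ∧ B.IsTree := by
  constructor
  · intro h
    obtain ⟨hA, hB⟩ := isAcyclic_bridgeSum.1 h.isAcyclic
    have key := fun a z ↦ bridgeSum_reachable_inl_iff.1 (h.preconnected (Sum.inl a) z)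
    have : Nonempty V := ⟨u⟩
    have : Nonempty W := ⟨w⟩
    exact ⟨⟨⟨fun a b ↦ key a (.inl b)⟩, hA⟩,
      ⟨⟨fun a b ↦ (key u (.inr a)).2.symm.trans (key u (.inr b)).2⟩, hB⟩⟩
  · rintro ⟨hA, hB⟩
    exact ⟨hA.connected.sum_sup_edge hB.connected,
      isAcyclic_bridgeSum.2 ⟨hA.isAcyclic, hB.isAcyclic⟩⟩

lemma connected_sup_edge_iff :
    (A ⊔ SimpleGraph.edge u v).Connected ↔ ∀ a, A.Reachable u a ∨ A.Reachable v a := by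
  constructor
  · intro h a
    refine (h.preconnected u a).mem_of_closed
      (s := {a | A.Reachable u a ∨ A.Reachable v a}) ?_ (.inl .rfl)
    intro c d hcd hc
    rw [SimpleGraph.sup_adj, SimpleGraph.edge_adj] at hcd
    rcases hcd with hcd | ⟨⟨rfl, rfl⟩ | ⟨rfl, rfl⟩, -⟩
    · exact hc.imp (·.trans hcd.reachable) (·.trans hcd.reachable)
    · exact .inr .rfl
    · exact .inl .rfl
  · intro h
    have huv : (A ⊔ SimpleGraph.edge u v).Reachable u v := by
      by_cases huv : u = v
      · exact huv ▸ .rfl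
      · exact SimpleGraph.Adj.reachable (by simp [SimpleGraph.edge_adj, huv])
    have hu : ∀ a, (A ⊔ SimpleGraph.edge u v).Reachable u a := fun a ↦
      (h a).elim (·.mono le_sup_left) (fun h ↦ huv.trans (h.mono le_sup_left))
    have : Nonempty V := ⟨u⟩
    exact ⟨fun a b ↦ (hu a).symm.trans (hu b)⟩

lemma connected_iff_of_base :
    A.Connected ↔ (∀ a, A.Reachable u a ∨ A.Reachable v a) ∧ A.Reachable u v := by
  refine ⟨fun h ↦ ⟨fun a ↦ .inl (h.preconnected u a), h.preconnected u v⟩, fun ⟨h, huv⟩ ↦ ?_⟩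
  have hu : ∀ a, A.Reachable u a := fun a ↦ (h a).elim id huv.trans
  have : Nonempty V := ⟨u⟩
  exact ⟨fun a b ↦ (hu a).symm.trans (hu b)⟩

/-- A spanning forest of `A` with two components, one containing `u` and the other `v`. -/
def IsSplit (A : SimpleGraph V) (u v : V) : Prop :=
  ¬A.Reachable u v ∧ (A ⊔ SimpleGraph.edge u v).IsTree

lemma isSplit_iff : IsSplit A u v ↔
    A.IsAcyclic ∧ (∀ a, A.Reachable u a ∨ A.Reachable v a) ∧ ¬A.Reachable u v := by
  rw [IsSplit, SimpleGraph.isTree_iff, connected_sup_edge_iff]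
  constructor
  · rintro ⟨h1, h2, h3⟩
    exact ⟨h3.anti le_sup_left, h2, h1⟩
  · rintro ⟨h1, h2, h3⟩
    exact ⟨h3, h2, (SimpleGraph.isAcyclic_add_edge_iff_of_not_reachable _ _ h3).2 h1⟩

lemma isTree_iff_of_base : A.IsTree ↔
    A.IsAcyclic ∧ (∀ a, A.Reachable u a ∨ A.Reachable v a) ∧ A.Reachable u v := by
  rw [SimpleGraph.isTree_iff, connected_iff_of_base (u := u) (v := v)]
  tauto

lemma doubleBridgeSum_connected_iff : (doubleBridgeSum A B u v w x).Connected ↔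
    (∀ a, A.Reachable u a ∨ A.Reachable v a) ∧ (∀ b, B.Reachable w b ∨ B.Reachable x b) ∧
      (A.Reachable u v ∨ B.Reachable w x) := by
  constructor
  · intro h
    have hp := h.preconnected
    refine ⟨fun a ↦ ?_, fun b ↦ ?_, ?_⟩
    · have := (hp (.inr w) (.inl a)).mem_of_closed (s := {z : V ⊕ W | z.elim
        (fun a ↦ A.Reachable u a ∨ A.Reachable v a) (fun _ ↦ True)}) ?_ (by simp)
      · simpa using this
      rintro (c | c) (d | d) hcd hc <;> simp at hcd hc ⊢
      · exact hc.imp (·.trans hcd.reachable) (·.trans hcd.reachable)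
      · rcases hcd with ⟨rfl, -⟩ | ⟨rfl, -⟩ <;> simp
    · have := (hp (.inl u) (.inr b)).mem_of_closed (s := {z : V ⊕ W | z.elim
        (fun _ ↦ True) (fun b ↦ B.Reachable w b ∨ B.Reachable x b)}) ?_ (by simp)
      · simpa using this
      rintro (c | c) (d | d) hcd hc <;> simp at hcd hc ⊢
      · rcases hcd with ⟨-, rfl⟩ | ⟨-, rfl⟩ <;> simp
      · exact hc.imp (·.trans hcd.reachable) (·.trans hcd.reachable)
    · by_contra! hn
      have := (hp (.inl u) (.inl v)).mem_of_closed (s := {z : V ⊕ W | z.elim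
        (fun a ↦ A.Reachable u a) (fun b ↦ B.Reachable w b)}) ?_ (by simp)
      · exact hn.1 (by simpa using this)
      rintro (c | c) (d | d) hcd hc <;> simp at hcd hc ⊢
      · exact hc.trans hcd.reachable
      · rcases hcd with ⟨rfl, rfl⟩ | ⟨rfl, rfl⟩
        · rfl
        · exact (hn.1 hc).elim
      · rcases hcd with ⟨rfl, rfl⟩ | ⟨rfl, rfl⟩
        · rfl
        · exact (hn.2 hc).elim
      · exact hc.trans hcd.reachable
  · rintro ⟨hA, hB, h⟩
    rw [doubleBridgeSum, connected_sup_edge_iff]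
    simp_rw [SimpleGraph.reachable_comm (u := Sum.inr x),
      bridgeSum_reachable_inl_iff]
    have hcross : (bridgeSum A B u w).Reachable (.inl u) (.inr w) :=
      SimpleGraph.Adj.reachable (by simp)
    rintro (a | b)
    · simp only [Sum.elim_inl]
      rcases hA a with ha | ha
      · rcases h with h | h
        · exact .inl (h.symm.trans ha)
        · exact .inr (bridgeSum_reachable_inl_iff.2 ⟨ha.symm, h⟩)
      · exact .inl ha
    · simp only [Sum.elim_inr]
      rcases hB b with hb | hb
      · rcases h with h | h
        · exact .inl ⟨h.symm, hb⟩
        · exact .inr (hb.symm.trans h).bridgeSum_inr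
      · exact .inr hb.symm.bridgeSum_inr

lemma doubleBridgeSum_isAcyclic_iff (h : ¬(u = v ∧ w = x)) :
    (doubleBridgeSum A B u v w x).IsAcyclic ↔
      A.IsAcyclic ∧ B.IsAcyclic ∧ ¬(A.Reachable u v ∧ B.Reachable w x) := by
  rw [doubleBridgeSum, SimpleGraph.isAcyclic_sup_fromEdgeSet_iff, isAcyclic_bridgeSum,
    bridgeSum_reachable_inl_iff, SimpleGraph.reachable_comm (u := u)]
  simp only [Sum.elim_inr, reduceCtorEq, bridgeSum_adj_inl_inr, false_or]
  grind

lemma doubleBridgeSum_isTree_iff (h : ¬(u = v ∧ w = x)) :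
    (doubleBridgeSum A B u v w x).IsTree ↔
      IsSplit A u v ∧ B.IsTree ∨ A.IsTree ∧ IsSplit B w x := by
  rw [SimpleGraph.isTree_iff, doubleBridgeSum_isAcyclic_iff h, doubleBridgeSum_connected_iff,
    isSplit_iff, isSplit_iff, isTree_iff_of_base (A := A) (u := u) (v := v),
    isTree_iff_of_base (A := B) (u := w) (v := x)]
  tauto

end TreesOfJoins

section Counting

variable {V W : Type}

/-- The spanning trees of `G` that do not use the edge `uv`. -/
def treesAvoiding (G : SimpleGraph V) (u v : V) : Set (SimpleGraph V) :=
  {A | A ≤ G ∧ A.IsTree ∧ ¬A.Adj u v}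

/-- The spanning trees of `G` that use the edge `uv`. -/
def treesThrough (G : SimpleGraph V) (u v : V) : Set (SimpleGraph V) :=
  {A | A ≤ G ∧ A.IsTree ∧ A.Adj u v}

/-- The spanning forests of `G` with two components, one containing `u` and the other `v`. -/
def splits (G : SimpleGraph V) (u v : V) : Set (SimpleGraph V) :=
  {A | A ≤ G ∧ IsSplit A u v}

/-- The graph obtained from `H` and `Q` by deleting the edge `uv` of `H` and adding the edges
`uw` and `vx`. -/
def splice (H : SimpleGraph V) (Q : SimpleGraph W) (u v : V) (w x : W) : SimpleGraph (V ⊕ W) :=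
  doubleBridgeSum (H.deleteEdges {s(u, v)}) Q u v w x

variable {H A A' : SimpleGraph V} {Q B B' : SimpleGraph W} {u v : V} {w x : W}

lemma le_deleteEdges_singleton_iff :
    A ≤ H.deleteEdges {s(u, v)} ↔ A ≤ H ∧ ¬A.Adj u v := by
  constructor
  · intro h
    exact ⟨h.trans (SimpleGraph.deleteEdges_le _), fun huv ↦ by simpa using h huv⟩
  · rintro ⟨h, huv⟩ a b hab
    rw [SimpleGraph.deleteEdges_adj]
    refine ⟨h hab, fun he ↦ huv ?_⟩
    rw [Set.mem_singleton_iff] at he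
    rwa [← SimpleGraph.mem_edgeSet, ← he]

lemma IsSplit.not_adj (h : IsSplit A u v) : ¬A.Adj u v := fun hA ↦ h.1 hA.reachable

lemma IsSplit.not_isTree (h : IsSplit A u v) : ¬A.IsTree := fun hA ↦ h.1 (hA.preconnected u v)

lemma ncard_splits (huv : H.Adj u v) : (splits H u v).ncard = (treesThrough H u v).ncard := by
  refine Set.ncard_congr (fun A _ ↦ A ⊔ SimpleGraph.edge u v) ?_ ?_ ?_
  · rintro A ⟨h1, h2⟩
    refine ⟨sup_le h1 ?_, h2.2, by simp [SimpleGraph.edge_adj, huv.ne]⟩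
    rw [SimpleGraph.edge_le_iff]
    exact .inr huv
  · rintro A A' ⟨-, h2⟩ ⟨-, h2'⟩ h
    have hA : ∀ A : SimpleGraph V, IsSplit A u v →
        (A ⊔ SimpleGraph.edge u v).deleteEdges {s(u, v)} = A := by
      intro A hA
      have := hA.not_adj
      ext a b
      simp only [SimpleGraph.deleteEdges_adj, SimpleGraph.sup_adj, SimpleGraph.edge_adj,
        Set.mem_singleton_iff, Sym2.eq_iff]
      have := A.adj_comm
      grind
    rw [← hA A h2, ← hA A' h2']
    exact congrArg (·.deleteEdges {s(u, v)}) h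
  · rintro A ⟨h1, h2, h3⟩
    have hA : A.deleteEdges {s(u, v)} ⊔ SimpleGraph.edge u v = A := by
      ext a b
      simp only [SimpleGraph.deleteEdges_adj, SimpleGraph.sup_adj, SimpleGraph.edge_adj,
        Set.mem_singleton_iff, Sym2.eq_iff]
      have := A.adj_comm
      have : A.Adj a b → a ≠ b := SimpleGraph.Adj.ne
      grind
    refine ⟨A.deleteEdges {s(u, v)}, ⟨(SimpleGraph.deleteEdges_le _).trans h1, ?_, ?_⟩, hA⟩
    · exact SimpleGraph.isBridge_iff.1
        (SimpleGraph.isAcyclic_iff_forall_adj_isBridge.1 h2.isAcyclic h3)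
    · rwa [hA]

lemma bridgeSum_inj (h : bridgeSum A B u w = bridgeSum A' B' u w) : A = A' ∧ B = B' := by
  constructor
  · ext a b
    rw [← bridgeSum_adj_inl_inl (B := B) (u := u) (w := w), h, bridgeSum_adj_inl_inl]
  · ext a b
    rw [← bridgeSum_adj_inr_inr (A := A) (u := u) (w := w), h, bridgeSum_adj_inr_inr]

lemma doubleBridgeSum_inj
    (h : doubleBridgeSum A B u v w x = doubleBridgeSum A' B' u v w x) : A = A' ∧ B = B' := by
  constructor
  · ext a b
    rw [← doubleBridgeSum_adj_inl_inl (B := B) (u := u) (v := v) (w := w) (x := x), h,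
      doubleBridgeSum_adj_inl_inl]
  · ext a b
    rw [← doubleBridgeSum_adj_inr_inr (A := A) (u := u) (v := v) (w := w) (x := x), h,
      doubleBridgeSum_adj_inr_inr]

lemma bridgeSum_le_bridgeSum (hA : A ≤ A') (hB : B ≤ B') :
    bridgeSum A B u w ≤ bridgeSum A' B' u w := by
  rintro (a | a) (b | b) hab <;> simp at hab ⊢
  · exact hA hab
  · exact hab
  · exact hab
  · exact hB hab

lemma doubleBridgeSum_le_doubleBridgeSum (hA : A ≤ A') (hB : B ≤ B') :
    doubleBridgeSum A B u v w x ≤ doubleBridgeSum A' B' u v w x :=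
  sup_le_sup_right (bridgeSum_le_bridgeSum hA hB) _

lemma bridgeSum_le_doubleBridgeSum : bridgeSum A B u w ≤ doubleBridgeSum A B u v w x :=
  le_sup_left

lemma bridgeSum_le_doubleBridgeSum' : bridgeSum A B v x ≤ doubleBridgeSum A B u v w x := by
  rintro (a | a) (b | b) hab <;> simp at hab ⊢ <;> simp [hab]

/-- A connected subgraph of `doubleBridgeSum H Q u v w x` uses one or both of the new edges. -/
lemma exists_of_le_doubleBridgeSum (huv : u ≠ v) {C : SimpleGraph (V ⊕ W)}
    (hC : C ≤ doubleBridgeSum H Q u v w x) (hconn : C.Connected) :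
    ∃ A ≤ H, ∃ B ≤ Q, C = bridgeSum A B u w ∨ C = bridgeSum A B v x ∨
      C = doubleBridgeSum A B u v w x := by
  refine ⟨C.comap Sum.inl, fun a b hab ↦ ?_, C.comap Sum.inr, fun a b hab ↦ ?_, ?_⟩
  · simpa using hC hab
  · simpa using hC hab
  have hcross : ∀ a b, C.Adj (.inl a) (.inr b) → a = u ∧ b = w ∨ a = v ∧ b = x :=
    fun a b hab ↦ by simpa using hC hab
  have hsymm : ∀ a b, C.Adj (.inr b) (.inl a) ↔ C.Adj (.inl a) (.inr b) :=
    fun a b ↦ C.adj_comm _ _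
  by_cases h1 : C.Adj (.inl u) (.inr w) <;> by_cases h2 : C.Adj (.inl v) (.inr x)
  · refine .inr (.inr ?_)
    ext (a | a) (b | b) <;> simp [hsymm] <;> grind
  · refine .inl ?_
    ext (a | a) (b | b) <;> simp [hsymm] <;> grind
  · refine .inr (.inl ?_)
    ext (a | a) (b | b) <;> simp [hsymm] <;> grind
  · have := (hconn.preconnected (.inl u) (.inr w)).mem_of_closed (s := Set.range Sum.inl) ?_
      ⟨u, rfl⟩
    · simp at this
    · rintro (a | a) (b | b) hab hc
      · simp
      · grind
      · simp
      · simp at hc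

/-- The spanning trees of a splice, in terms of the bits of the two new edges. -/
lemma mem_trees_splice_iff (huv : u ≠ v) (C : SimpleGraph (V ⊕ W)) :
    C ≤ splice H Q u v w x ∧ C.IsTree ↔ ∃ A B, B ≤ Q ∧
      (A ∈ treesAvoiding H u v ∧ B.IsTree ∧ C = bridgeSum A B u w ∨
        A ∈ treesAvoiding H u v ∧ B.IsTree ∧ C = bridgeSum A B v x ∨
        (A ∈ splits H u v ∧ B.IsTree ∨ A ∈ treesAvoiding H u v ∧ B ∈ splits Q w x) ∧
          C = doubleBridgeSum A B u v w x) := by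
  constructor
  · rintro ⟨hC, hT⟩
    obtain ⟨A, hA, B, hB, h⟩ := exists_of_le_doubleBridgeSum huv hC hT.connected
    rw [le_deleteEdges_singleton_iff] at hA
    refine ⟨A, B, hB, ?_⟩
    rcases h with rfl | rfl | rfl
    · rw [isTree_bridgeSum] at hT
      exact .inl ⟨⟨hA.1, hT.1, hA.2⟩, hT.2, rfl⟩
    · rw [isTree_bridgeSum] at hT
      exact .inr (.inl ⟨⟨hA.1, hT.1, hA.2⟩, hT.2, rfl⟩)
    · rw [doubleBridgeSum_isTree_iff (by tauto)] at hT
      refine .inr (.inr ⟨?_, rfl⟩)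
      rcases hT with hT | hT
      · exact .inl ⟨⟨hA.1, hT.1⟩, hT.2⟩
      · exact .inr ⟨⟨hA.1, hT.1, hA.2⟩, hB, hT.2⟩
  · rintro ⟨A, B, hB, ⟨hA, hBT, rfl⟩ | ⟨hA, hBT, rfl⟩ | ⟨h, rfl⟩⟩
    · exact ⟨(bridgeSum_le_bridgeSum (le_deleteEdges_singleton_iff.2 ⟨hA.1, hA.2.2⟩) hB).trans
        bridgeSum_le_doubleBridgeSum, isTree_bridgeSum.2 ⟨hA.2.1, hBT⟩⟩
    · exact ⟨(bridgeSum_le_bridgeSum (le_deleteEdges_singleton_iff.2 ⟨hA.1, hA.2.2⟩) hB).trans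
        bridgeSum_le_doubleBridgeSum', isTree_bridgeSum.2 ⟨hA.2.1, hBT⟩⟩
    · refine ⟨doubleBridgeSum_le_doubleBridgeSum (le_deleteEdges_singleton_iff.2 ?_) hB,
        (doubleBridgeSum_isTree_iff (by tauto)).2 ?_⟩
      · rcases h with h | h
        · exact ⟨h.1.1, h.1.2.not_adj⟩
        · exact ⟨h.1.1, h.1.2.2⟩
      · rcases h with h | h
        · exact .inl ⟨h.1.2, h.2⟩
        · exact .inr ⟨h.1.2.1, h.2.2⟩

lemma ncard_image_bridgeSum (s : Set (SimpleGraph V × SimpleGraph W)) :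
    ((fun p ↦ bridgeSum p.1 p.2 u w) '' s).ncard = s.ncard :=
  Set.ncard_image_of_injective _ fun _ _ h ↦ Prod.ext (bridgeSum_inj h).1 (bridgeSum_inj h).2

lemma ncard_image_doubleBridgeSum (s : Set (SimpleGraph V × SimpleGraph W)) :
    ((fun p ↦ doubleBridgeSum p.1 p.2 u v w x) '' s).ncard = s.ncard :=
  Set.ncard_image_of_injective _ fun _ _ h ↦
    Prod.ext (doubleBridgeSum_inj h).1 (doubleBridgeSum_inj h).2

lemma treesAvoiding_union :
    treesAvoiding Q w x ∪ treesThrough Q w x = {B | B ≤ Q ∧ B.IsTree} := by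
  ext B
  simp only [treesAvoiding, treesThrough, Set.mem_union, Set.mem_ofPred_eq]
  tauto

variable [Finite W]

lemma ncard_bridgeSum_union [Finite V] (huv : u ≠ v) (s t r : Set (SimpleGraph V × SimpleGraph W)) :
    ((fun p ↦ bridgeSum p.1 p.2 u w) '' s ∪ ((fun p ↦ bridgeSum p.1 p.2 v x) '' t ∪
      (fun p ↦ doubleBridgeSum p.1 p.2 u v w x) '' r)).ncard =
      s.ncard + (t.ncard + r.ncard) := by
  rw [Set.ncard_union_eq, Set.ncard_union_eq, ncard_image_bridgeSum, ncard_image_bridgeSum,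
    ncard_image_doubleBridgeSum]
  · rw [Set.disjoint_left]
    rintro _ ⟨p, -, rfl⟩ ⟨q, -, h⟩
    have : (doubleBridgeSum q.1 q.2 u v w x).Adj (.inl u) (.inr w) := by simp
    simp only [h, bridgeSum_adj_inl_inr] at this
    exact huv this.1
  · rw [Set.disjoint_left]
    rintro _ ⟨p, -, rfl⟩ (⟨q, -, h⟩ | ⟨q, -, h⟩)
    · have : (bridgeSum q.1 q.2 v x).Adj (.inl v) (.inr x) := by simp
      simp only [h, bridgeSum_adj_inl_inr] at this
      exact huv this.1.symm
    · have : (doubleBridgeSum q.1 q.2 u v w x).Adj (.inl v) (.inr x) := by simp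
      simp only [h, bridgeSum_adj_inl_inr] at this
      exact huv this.1.symm

lemma ncard_splits_prod_union [Finite V] (huv : H.Adj u v) (X Y : Set (SimpleGraph W)) :
    (splits H u v ×ˢ X ∪ treesAvoiding H u v ×ˢ Y).ncard =
      (treesThrough H u v).ncard * X.ncard + (treesAvoiding H u v).ncard * Y.ncard := by
  rw [Set.ncard_union_eq, Set.ncard_prod, Set.ncard_prod, ncard_splits huv]
  rw [Set.disjoint_left]
  rintro p ⟨h, -⟩ ⟨h', -⟩
  exact h.2.not_isTree h'.2.1

lemma ncard_treesAvoiding_union :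
    (treesAvoiding Q w x ∪ treesThrough Q w x).ncard =
      (treesAvoiding Q w x).ncard + (treesThrough Q w x).ncard := by
  rw [Set.ncard_union_eq]
  rw [Set.disjoint_left]
  exact fun B h h' ↦ h.2.2 h'.2.2

lemma ncard_treesAvoiding_splice_cross (huv : H.Adj u v) :
    (treesAvoiding (splice H Q u v w x) (.inl v) (.inr x)).ncard =
      (treesAvoiding H u v).ncard *
        ((treesAvoiding Q w x).ncard + (treesThrough Q w x).ncard) := by
  rw [← ncard_treesAvoiding_union, ← Set.ncard_prod, ← ncard_image_bridgeSum (u := u) (w := w)]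
  congr 1
  ext C
  rw [treesAvoiding_union, treesAvoiding, Set.mem_ofPred_eq, ← and_assoc,
    mem_trees_splice_iff huv.ne]
  constructor
  · rintro ⟨⟨A, B, hB, ⟨hA, hT, rfl⟩ | ⟨hA, hT, rfl⟩ | ⟨h, rfl⟩⟩, hn⟩
    · exact ⟨(A, B), ⟨hA, hB, hT⟩, rfl⟩
    · simp at hn
    · simp at hn
  · rintro ⟨⟨A, B⟩, ⟨hA, hB, hT⟩, rfl⟩
    exact ⟨⟨A, B, hB, .inl ⟨hA, hT, rfl⟩⟩, by simp [huv.ne.symm]⟩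

lemma ncard_treesThrough_splice_cross [Finite V] (huv : H.Adj u v) (hwx : Q.Adj w x) :
    (treesThrough (splice H Q u v w x) (.inl v) (.inr x)).ncard =
      (treesAvoiding H u v).ncard *
          ((treesAvoiding Q w x).ncard + (treesThrough Q w x).ncard) +
        ((treesThrough H u v).ncard *
            ((treesAvoiding Q w x).ncard + (treesThrough Q w x).ncard) +
          (treesAvoiding H u v).ncard * (treesThrough Q w x).ncard) := by
  have key := ncard_bridgeSum_union (w := w) (x := x) huv.ne ∅
    (treesAvoiding H u v ×ˢ (treesAvoiding Q w x ∪ treesThrough Q w x))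
    (splits H u v ×ˢ (treesAvoiding Q w x ∪ treesThrough Q w x) ∪
      treesAvoiding H u v ×ˢ splits Q w x)
  rw [ncard_splits_prod_union huv, Set.ncard_prod, ncard_treesAvoiding_union, Set.ncard_empty,
    zero_add, ncard_splits hwx] at key
  rw [← key]
  congr 1
  ext C
  rw [treesAvoiding_union, treesThrough, Set.mem_ofPred_eq, ← and_assoc,
    mem_trees_splice_iff huv.ne, Set.image_empty, Set.empty_union]
  constructor
  · rintro ⟨⟨A, B, hB, ⟨hA, hT, rfl⟩ | ⟨hA, hT, rfl⟩ | ⟨h, rfl⟩⟩, hn⟩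
    · simp [huv.ne.symm] at hn
    · exact .inl ⟨(A, B), ⟨hA, hB, hT⟩, rfl⟩
    · refine .inr ⟨(A, B), h.imp (fun h ↦ ⟨h.1, hB, h.2⟩) (fun h ↦ h), rfl⟩
  · rintro (⟨⟨A, B⟩, ⟨hA, hB, hT⟩, rfl⟩ | ⟨⟨A, B⟩, h, rfl⟩)
    · exact ⟨⟨A, B, hB, .inr (.inl ⟨hA, hT, rfl⟩)⟩, by simp⟩
    · refine ⟨⟨A, B, ?_, .inr (.inr ⟨h.imp (fun h ↦ ⟨h.1, h.2.2⟩) (fun h ↦ h), rfl⟩)⟩, by simp⟩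
      exact h.elim (·.2.1) (·.2.1)

lemma ncard_treesAvoiding_splice_inner [Finite V] (huv : H.Adj u v) (hwx : Q.Adj w x) :
    (treesAvoiding (splice H Q u v w x) (.inr w) (.inr x)).ncard =
      (treesAvoiding H u v).ncard * (treesAvoiding Q w x).ncard +
        ((treesAvoiding H u v).ncard * (treesAvoiding Q w x).ncard +
          ((treesThrough H u v).ncard * (treesAvoiding Q w x).ncard +
            (treesAvoiding H u v).ncard * (treesThrough Q w x).ncard)) := by
  have key := ncard_bridgeSum_union (w := w) (x := x) huv.ne
    (treesAvoiding H u v ×ˢ treesAvoiding Q w x) (treesAvoiding H u v ×ˢ treesAvoiding Q w x)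
    (splits H u v ×ˢ treesAvoiding Q w x ∪ treesAvoiding H u v ×ˢ splits Q w x)
  rw [ncard_splits_prod_union huv, Set.ncard_prod, ncard_splits hwx] at key
  rw [← key]
  congr 1
  ext C
  rw [treesAvoiding, Set.mem_ofPred_eq, ← and_assoc, mem_trees_splice_iff huv.ne]
  constructor
  · rintro ⟨⟨A, B, hB, ⟨hA, hT, rfl⟩ | ⟨hA, hT, rfl⟩ | ⟨h, rfl⟩⟩, hn⟩
    · exact .inl ⟨(A, B), ⟨hA, hB, hT, by simpa using hn⟩, rfl⟩
    · exact .inr (.inl ⟨(A, B), ⟨hA, hB, hT, by simpa using hn⟩, rfl⟩)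
    · exact .inr (.inr ⟨(A, B), h.imp (fun h ↦ ⟨h.1, hB, h.2, by simpa using hn⟩) (fun h ↦ h), rfl⟩)
  · rintro (⟨⟨A, B⟩, ⟨hA, hB, hT, hn⟩, rfl⟩ | ⟨⟨A, B⟩, ⟨hA, hB, hT, hn⟩, rfl⟩ | ⟨⟨A, B⟩, h, rfl⟩)
    · exact ⟨⟨A, B, hB, .inl ⟨hA, hT, rfl⟩⟩, by simpa using hn⟩
    · exact ⟨⟨A, B, hB, .inr (.inl ⟨hA, hT, rfl⟩)⟩, by simpa using hn⟩
    · refine ⟨⟨A, B, ?_, .inr (.inr ⟨h.imp (fun h ↦ ⟨h.1, h.2.2.1⟩) (fun h ↦ h), rfl⟩)⟩, ?_⟩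
      · exact h.elim (·.2.1) (·.2.1)
      · simpa using h.elim (·.2.2.2) (·.2.2.not_adj)

lemma ncard_treesThrough_splice_inner [Finite V] (huv : H.Adj u v) :
    (treesThrough (splice H Q u v w x) (.inr w) (.inr x)).ncard =
      (treesAvoiding H u v).ncard * (treesThrough Q w x).ncard +
        ((treesAvoiding H u v).ncard * (treesThrough Q w x).ncard +
          (treesThrough H u v).ncard * (treesThrough Q w x).ncard) := by
  have key := ncard_bridgeSum_union (w := w) (x := x) huv.ne
    (treesAvoiding H u v ×ˢ treesThrough Q w x) (treesAvoiding H u v ×ˢ treesThrough Q w x)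
    (splits H u v ×ˢ treesThrough Q w x)
  rw [Set.ncard_prod, Set.ncard_prod, ncard_splits huv] at key
  rw [← key]
  congr 1
  ext C
  rw [treesThrough, Set.mem_ofPred_eq, ← and_assoc, mem_trees_splice_iff huv.ne]
  constructor
  · rintro ⟨⟨A, B, hB, ⟨hA, hT, rfl⟩ | ⟨hA, hT, rfl⟩ | ⟨h, rfl⟩⟩, hn⟩
    · exact .inl ⟨(A, B), ⟨hA, hB, hT, by simpa using hn⟩, rfl⟩
    · exact .inr (.inl ⟨(A, B), ⟨hA, hB, hT, by simpa using hn⟩, rfl⟩)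
    · rcases h with h | h
      · exact .inr (.inr ⟨(A, B), ⟨h.1, hB, h.2, by simpa using hn⟩, rfl⟩)
      · exact (h.2.2.not_adj (by simpa using hn)).elim
  · rintro (⟨⟨A, B⟩, ⟨hA, hB, hT, hn⟩, rfl⟩ | ⟨⟨A, B⟩, ⟨hA, hB, hT, hn⟩, rfl⟩ |
      ⟨⟨A, B⟩, ⟨hA, hB, hT, hn⟩, rfl⟩)
    · exact ⟨⟨A, B, hB, .inl ⟨hA, hT, rfl⟩⟩, by simpa using hn⟩
    · exact ⟨⟨A, B, hB, .inr (.inl ⟨hA, hT, rfl⟩)⟩, by simpa using hn⟩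
    · exact ⟨⟨A, B, hB, .inr (.inr ⟨.inl ⟨hA, hT⟩, rfl⟩)⟩, by simpa using hn⟩

end Counting

section Splicing

variable {V W : Type} {H : SimpleGraph V} {Q : SimpleGraph W} {u v : V} {w x : W}

lemma splice_neighborSet_inl_ncard (huv : H.Adj u v) (a : V) :
    ((splice H Q u v w x).neighborSet (.inl a)).ncard = (H.neighborSet a).ncard := by
  classical
  set f : V → V ⊕ W := fun b ↦
    if a = u ∧ b = v then .inr w else if a = v ∧ b = u then .inr x else .inl b with hf
  have hinj : Function.Injective f := by
    intro b c h
    have := huv.ne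
    simp only [hf] at h
    grind
  rw [← Set.ncard_image_of_injective _ hinj]
  congr 1
  ext (b | b)
  · have := huv.ne
    have := huv.symm
    simp only [splice, SimpleGraph.mem_neighborSet, doubleBridgeSum_adj_inl_inl,
      SimpleGraph.deleteEdges_adj, Set.mem_singleton_iff, Sym2.eq_iff, Set.mem_image, hf]
    grind
  · have := huv.ne
    have := huv.symm
    simp only [splice, SimpleGraph.mem_neighborSet, doubleBridgeSum_adj_inl_inr, Set.mem_image, hf]
    grind

lemma splice_neighborSet_inr_of_ne {b : W} (hw : b ≠ w) (hx : b ≠ x) :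
    ((splice H Q u v w x).neighborSet (.inr b)).ncard = (Q.neighborSet b).ncard := by
  rw [← Set.ncard_image_of_injective (Q.neighborSet b) (Sum.inr_injective (α := V))]
  congr 1
  ext (c | c) <;> simp [splice, hw, hx]

lemma splice_neighborSet_inr_left [Finite W] (hwx : w ≠ x) :
    ((splice H Q u v w x).neighborSet (.inr w)).ncard = (Q.neighborSet w).ncard + 1 := by
  rw [← Set.ncard_image_of_injective (Q.neighborSet w) (Sum.inr_injective (α := V)),
    ← Set.ncard_insert_of_notMem (a := Sum.inl u) (by simp) (Set.toFinite _)]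
  congr 1
  ext (c | c) <;> simp [splice, hwx]

lemma splice_neighborSet_inr_right [Finite W] (hwx : w ≠ x) :
    ((splice H Q u v w x).neighborSet (.inr x)).ncard = (Q.neighborSet x).ncard + 1 := by
  rw [← Set.ncard_image_of_injective (Q.neighborSet x) (Sum.inr_injective (α := V)),
    ← Set.ncard_insert_of_notMem (a := Sum.inl v) (by simp) (Set.toFinite _)]
  congr 1
  ext (c | c) <;> simp [splice, hwx.symm]

/-- There is a `k`-regular graph on `n` vertices with an edge that is avoided by `p.1` and used by
`p.2` of its spanning trees. -/
def Realizes (k n : ℕ) (p : ℕ × ℕ) : Prop :=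
  ∃ (V : Type) (_ : Finite V) (G : SimpleGraph V) (u v : V), Nat.card V = n ∧
    (∀ a, (G.neighborSet a).ncard = k) ∧ G.Adj u v ∧
    (treesAvoiding G u v).ncard = p.1 ∧ (treesThrough G u v).ncard = p.2

/-- `Q` becomes part of a `k`-regular graph when one further edge is attached to each of its
adjacent vertices `w` and `x`. -/
structure IsGadget (k : ℕ) (Q : SimpleGraph W) (w x : W) : Prop where
  adj : Q.Adj w x
  ncard_left : (Q.neighborSet w).ncard + 1 = k
  ncard_right : (Q.neighborSet x).ncard + 1 = k
  ncard_of_ne : ∀ b, b ≠ w → b ≠ x → (Q.neighborSet b).ncard = k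

/-- The effect of a splice on the numbers of trees avoiding and using a marked edge, when the new
marked edge is one of the two added edges. -/
def seriesMap (a b : ℕ) (p : ℕ × ℕ) : ℕ × ℕ :=
  (p.1 * (a + b), p.1 * (a + b) + (p.2 * (a + b) + p.1 * b))

/-- The effect of a splice on the numbers of trees avoiding and using a marked edge, when the new
marked edge is that of the gadget. -/
def parallelMap (a b : ℕ) (p : ℕ × ℕ) : ℕ × ℕ :=
  (p.1 * a + (p.1 * a + (p.2 * a + p.1 * b)), p.1 * b + (p.1 * b + p.2 * b))

lemma IsGadget.splice_regular [Finite W] {k : ℕ} (hQ : IsGadget k Q w x) (huv : H.Adj u v)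
    (hH : ∀ a, (H.neighborSet a).ncard = k) (z : V ⊕ W) :
    ((splice H Q u v w x).neighborSet z).ncard = k := by
  rcases z with a | b
  · rw [splice_neighborSet_inl_ncard huv, hH]
  · by_cases hw : b = w
    · rw [hw, splice_neighborSet_inr_left hQ.adj.ne, hQ.ncard_left]
    by_cases hx : b = x
    · rw [hx, splice_neighborSet_inr_right hQ.adj.ne, hQ.ncard_right]
    rw [splice_neighborSet_inr_of_ne hw hx, hQ.ncard_of_ne b hw hx]

lemma Realizes.series [Finite W] {k n : ℕ} {p : ℕ × ℕ} (hQ : IsGadget k Q w x)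
    (h : Realizes k n p) :
    Realizes k (n + Nat.card W)
      (seriesMap (treesAvoiding Q w x).ncard (treesThrough Q w x).ncard p) := by
  obtain ⟨V, _, H, u, v, hn, hH, huv, hT, hF⟩ := h
  refine ⟨V ⊕ W, inferInstance, splice H Q u v w x, .inl v, .inr x, ?_,
    hQ.splice_regular huv hH, by simp [splice], ?_, ?_⟩
  · rw [Nat.card_sum, hn]
  · rw [ncard_treesAvoiding_splice_cross huv, hT, seriesMap]
  · rw [ncard_treesThrough_splice_cross huv hQ.adj, hT, hF, seriesMap]

lemma Realizes.parallel [Finite W] {k n : ℕ} {p : ℕ × ℕ} (hQ : IsGadget k Q w x)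
    (h : Realizes k n p) :
    Realizes k (n + Nat.card W)
      (parallelMap (treesAvoiding Q w x).ncard (treesThrough Q w x).ncard p) := by
  obtain ⟨V, _, H, u, v, hn, hH, huv, hT, hF⟩ := h
  refine ⟨V ⊕ W, inferInstance, splice H Q u v w x, .inr w, .inr x, ?_,
    hQ.splice_regular huv hH, by simpa [splice] using hQ.adj, ?_, ?_⟩
  · rw [Nat.card_sum, hn]
  · rw [ncard_treesAvoiding_splice_inner huv hQ.adj, hT, hF, parallelMap]
  · rw [ncard_treesThrough_splice_inner huv, hT, hF, parallelMap]

lemma numSpanningTrees_comap {V' : Type} [Fintype V] [Fintype V'] (e : V' ≃ V)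
    (G : SimpleGraph V) : numSpanningTrees (G.comap e) = numSpanningTrees G := by
  refine (Set.ncard_congr (fun T _ ↦ T.comap e) ?_ ?_ ?_).symm
  · rintro T ⟨h1, h2⟩
    exact ⟨fun a b hab ↦ h1 hab, (SimpleGraph.Iso.comap e T).isTree_iff.2 h2⟩
  · intro T T' _ _ h
    ext a b
    have := congrArg (fun G : SimpleGraph V' ↦ G.Adj (e.symm a) (e.symm b)) h
    simpa using this
  · rintro T ⟨h1, h2⟩
    refine ⟨T.comap e.symm, ⟨fun a b hab ↦ ?_, (SimpleGraph.Iso.comap e.symm T).isTree_iff.2 h2⟩, ?_⟩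
    · simpa using h1 hab
    · ext a b
      simp

lemma Realizes.exists_graph {k n : ℕ} {p : ℕ × ℕ} (h : Realizes k n p) (hp : 0 < p.1 + p.2) :
    ∃ G : SimpleGraph (Fin n), G.Connected ∧ (∀ v : Fin n, (G.neighborSet v).ncard = k) ∧
      numSpanningTrees G = p.1 + p.2 := by
  obtain ⟨V, _, H, u, v, rfl, hH, huv, hT, hF⟩ := h
  have := Fintype.ofFinite V
  have hnum : numSpanningTrees H = p.1 + p.2 := by
    rw [numSpanningTrees, ← hT, ← hF, ← ncard_treesAvoiding_union, treesAvoiding_union]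
  have hconn : H.Connected := by
    rw [← hnum, numSpanningTrees, Set.ncard_pos] at hp
    obtain ⟨T, hT, hT'⟩ := hp
    exact hT'.connected.mono hT
  set e : Fin (Nat.card V) ≃ V := (Finite.equivFin V).symm
  refine ⟨H.comap e, (SimpleGraph.Iso.comap e H).connected_iff.2 hconn, fun a ↦ ?_, ?_⟩
  · rw [← hH (e a), ← Set.ncard_image_of_injective _ e.injective]
    congr 1
    ext b
    simp only [Set.mem_image, SimpleGraph.mem_neighborSet, SimpleGraph.comap_adj]
    exact ⟨fun ⟨c, hc, h⟩ ↦ h ▸ hc, fun h ↦ ⟨e.symm b, by simpa using h, by simp⟩⟩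
  · rw [numSpanningTrees_comap, hnum]

lemma ncard_treesAvoiding_pos [Finite W] (h : (Q.deleteEdges {s(w, x)}).Connected) :
    0 < (treesAvoiding Q w x).ncard := by
  obtain ⟨T, hT, hT'⟩ := h.exists_isTree_le
  rw [le_deleteEdges_singleton_iff] at hT
  exact (Set.ncard_pos).2 ⟨T, hT.1, hT', hT.2⟩

lemma ncard_treesThrough_pos [Finite W] (h : Q.Connected) (hwx : Q.Adj w x) :
    0 < (treesThrough Q w x).ncard := by
  have hle : ⊥ ⊔ SimpleGraph.edge w x ≤ Q :=
    sup_le bot_le ((SimpleGraph.edge_le_iff _).2 (.inr hwx))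
  obtain ⟨T, hT1, hT2, hT3⟩ := h.exists_isTree_le_of_le_of_isAcyclic hle
    (SimpleGraph.isAcyclic_bot.sup_edge_of_not_reachable (by simpa using hwx.ne))
  exact (Set.ncard_pos).2 ⟨T, hT2, hT3, hT1 (by simp [SimpleGraph.edge_adj, hwx.ne])⟩

end Splicing

section Gadget

variable {k : ℕ}

/-- The complement, within the complete bipartite graph, of the edges of `gadget`. -/
def GadgetNonadj (i j : ℕ) : Prop :=
  i = 0 ∧ (j = 1 ∨ j = 2) ∨ j = 0 ∧ (i = 1 ∨ i = 2) ∨ i = j ∧ 3 ≤ i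

lemma gadgetNonadj_comm (i j : ℕ) : GadgetNonadj i j ↔ GadgetNonadj j i := by
  unfold GadgetNonadj
  omega

/-- A bipartite graph on `2 * (k + 1)` vertices in which two adjacent vertices have degree `k - 1`
and the others have degree `k`. -/
def gadget (k : ℕ) : SimpleGraph (Fin (k + 1) ⊕ Fin (k + 1)) where
  Adj
    | .inl i, .inr j => ¬GadgetNonadj i j
    | .inr j, .inl i => ¬GadgetNonadj i j
    | _, _ => False
  symm := ⟨by rintro (i | i) (j | j) h <;> exact h⟩
  loopless := ⟨by rintro (i | i) h <;> exact h⟩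

@[simp] lemma gadget_adj_inl_inr {i j : Fin (k + 1)} :
    (gadget k).Adj (.inl i) (.inr j) ↔ ¬GadgetNonadj i j := Iff.rfl

@[simp] lemma gadget_adj_inr_inl {i j : Fin (k + 1)} :
    (gadget k).Adj (.inr j) (.inl i) ↔ ¬GadgetNonadj i j := Iff.rfl

@[simp] lemma gadget_not_adj_inl_inl {i j : Fin (k + 1)} :
    ¬(gadget k).Adj (.inl i) (.inl j) := id

@[simp] lemma gadget_not_adj_inr_inr {i j : Fin (k + 1)} :
    ¬(gadget k).Adj (.inr i) (.inr j) := id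

lemma ncard_not_gadgetNonadj_zero (hk : 3 ≤ k) :
    {j : Fin (k + 1) | ¬GadgetNonadj 0 j}.ncard + 1 = k := by
  have : {j : Fin (k + 1) | ¬GadgetNonadj 0 j} =
      {(⟨1, by omega⟩ : Fin (k + 1)), (⟨2, by omega⟩ : Fin (k + 1))}ᶜ := by
    ext j
    change ¬GadgetNonadj 0 j ↔ ¬(j = _ ∨ j = _)
    rw [Fin.ext_iff, Fin.ext_iff]
    unfold GadgetNonadj
    dsimp only
    omega
  rw [this, Set.ncard_compl, Set.ncard_pair (by simp), Nat.card_fin]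
  omega

lemma ncard_not_gadgetNonadj {i : Fin (k + 1)} (hi : i ≠ 0) :
    {j : Fin (k + 1) | ¬GadgetNonadj i j}.ncard = k := by
  have hi' : (i : ℕ) ≠ 0 := fun h ↦ hi (Fin.ext h)
  have : {j : Fin (k + 1) | ¬GadgetNonadj i j} = {if (i : ℕ) < 3 then 0 else i}ᶜ := by
    ext j
    change ¬GadgetNonadj i j ↔ ¬j = _
    rw [Fin.ext_iff, apply_ite Fin.val, Fin.val_zero]
    unfold GadgetNonadj
    split_ifs <;> omega
  rw [this, Set.ncard_compl, Set.ncard_singleton, Nat.card_fin]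
  omega

lemma gadget_neighborSet_inl (i : Fin (k + 1)) :
    ((gadget k).neighborSet (.inl i)).ncard = {j : Fin (k + 1) | ¬GadgetNonadj i j}.ncard := by
  rw [← Set.ncard_image_of_injective {j : Fin (k + 1) | ¬GadgetNonadj i j}
    (Sum.inr_injective (α := Fin (k + 1)))]
  congr 1
  ext (j | j) <;> simp

lemma gadget_neighborSet_inr (i : Fin (k + 1)) :
    ((gadget k).neighborSet (.inr i)).ncard = {j : Fin (k + 1) | ¬GadgetNonadj i j}.ncard := by
  rw [← Set.ncard_image_of_injective {j : Fin (k + 1) | ¬GadgetNonadj i j}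
    (Sum.inl_injective (β := Fin (k + 1)))]
  congr 1
  ext (j | j) <;> simp [gadgetNonadj_comm i]

lemma isGadget_gadget (hk : 3 ≤ k) : IsGadget k (gadget k) (.inl 0) (.inr 0) where
  adj := by simp [GadgetNonadj]
  ncard_left := by rw [gadget_neighborSet_inl]; exact ncard_not_gadgetNonadj_zero hk
  ncard_right := by rw [gadget_neighborSet_inr]; exact ncard_not_gadgetNonadj_zero hk
  ncard_of_ne := by
    rintro (i | i) h1 h2
    · rw [gadget_neighborSet_inl, ncard_not_gadgetNonadj (by simpa using h1)]
    · rw [gadget_neighborSet_inr, ncard_not_gadgetNonadj (by simpa using h2)]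

lemma gadget_deleteEdges_connected (hk : 3 ≤ k) :
    ((gadget k).deleteEdges {s(.inl 0, .inr 0)}).Connected := by
  set G := (gadget k).deleteEdges {s(.inl 0, .inr 0)} with hG
  have hadj : ∀ i j : Fin (k + 1), ¬GadgetNonadj i j → ((i : ℕ) ≠ 0 ∨ (j : ℕ) ≠ 0) →
      G.Reachable (.inl i) (.inr j) := by
    intro i j h hij
    refine SimpleGraph.Adj.reachable ?_
    simp only [hG, SimpleGraph.deleteEdges_adj, gadget_adj_inl_inr, Set.mem_singleton_iff,
      Sym2.eq_iff, Sum.inl.injEq, Sum.inr.injEq, Fin.ext_iff, Fin.val_zero]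
    refine ⟨h, ?_⟩
    simp only [reduceCtorEq, false_and, or_false]
    omega
  have hl : ∀ i : Fin (k + 1), (i : ℕ) ≠ 0 → G.Reachable (.inl i) (.inr ⟨1, by omega⟩) := by
    intro i hi
    exact hadj _ _ (by unfold GadgetNonadj; dsimp only; omega) (.inl hi)
  have hr : ∀ j : Fin (k + 1), (j : ℕ) ≠ 0 → G.Reachable (.inr j) (.inr ⟨1, by omega⟩) := by
    intro j hj
    exact (hadj ⟨1, by omega⟩ j (by unfold GadgetNonadj; dsimp only; omega) (.inr hj)).symm.trans
      (hl ⟨1, by omega⟩ (by simp))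
  have h3l : G.Reachable (.inl 0) (.inr ⟨3, by omega⟩) :=
    hadj 0 ⟨3, by omega⟩ (by simp [GadgetNonadj]) (by simp)
  have h3r : G.Reachable (.inl ⟨3, by omega⟩) (.inr 0) :=
    hadj ⟨3, by omega⟩ 0 (by simp [GadgetNonadj]) (by simp)
  have hbase : ∀ z, G.Reachable z (.inr ⟨1, by omega⟩) := by
    rintro (i | j)
    · by_cases hi : i = 0
      · exact hi ▸ h3l.trans (hr _ (by simp))
      · exact hl i (fun h ↦ hi (Fin.ext h))
    · by_cases hj : j = 0
      · exact hj ▸ h3r.symm.trans (hl _ (by simp))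
      · exact hr j (fun h ↦ hj (Fin.ext h))
  exact ⟨fun a b ↦ (hbase a).trans (hbase b).symm⟩

end Gadget

section Circulant

/-- The representatives of a symmetric set of `k` nonzero residues modulo `n`. -/
def jumps (k n : ℕ) : Finset ℕ :=
  (Finset.Icc 1 (k / 2) ∪ Finset.Ico (n - k / 2) n) ∪ if Even k then ∅ else {n / 2}

variable {k n : ℕ}

lemma mem_jumps {i : ℕ} : i ∈ jumps k n ↔
    (1 ≤ i ∧ i ≤ k / 2 ∨ n - k / 2 ≤ i ∧ i < n) ∨ (¬Even k ∧ i = n / 2) := by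
  unfold jumps
  split_ifs with h <;> simp [h, or_comm]

lemma even_of_even_mul_of_not_even (hkn : Even (k * n)) (hk : ¬Even k) : n % 2 = 0 :=
  Nat.even_iff.1 ((Nat.even_mul.1 hkn).resolve_left hk)

lemma card_jumps (hn : k + 2 ≤ n) (hkn : Even (k * n)) : (jumps k n).card = k := by
  unfold jumps
  have h1 : Disjoint (Finset.Icc 1 (k / 2)) (Finset.Ico (n - k / 2) n) := by
    rw [Finset.disjoint_left]
    intro i
    simp
    omega
  split_ifs with hk
  · rw [Finset.union_empty, Finset.card_union_of_disjoint h1, Nat.card_Icc, Nat.card_Ico]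
    have := Nat.even_iff.1 hk
    omega
  · have hn2 := even_of_even_mul_of_not_even hkn hk
    have := Nat.odd_iff.1 (Nat.not_even_iff_odd.1 hk)
    rw [Finset.card_union_of_disjoint, Finset.card_union_of_disjoint h1, Nat.card_Icc,
      Nat.card_Ico, Finset.card_singleton]
    · omega
    · simp
      omega

/-- The residues modulo `n` represented by `jumps k n`. -/
def jumpSet (k n : ℕ) : Set (ZMod n) := (fun i : ℕ ↦ (i : ZMod n)) '' (jumps k n)

lemma pos_and_lt_of_mem_jumps (hn : k + 2 ≤ n) {i : ℕ} (hi : i ∈ jumps k n) : 0 < i ∧ i < n := by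
  rw [mem_jumps] at hi
  omega

lemma ncard_jumpSet (hn : k + 2 ≤ n) (hkn : Even (k * n)) : (jumpSet k n).ncard = k := by
  rw [jumpSet, Set.InjOn.ncard_image, Set.ncard_coe_finset, card_jumps hn hkn]
  intro i hi j hj hij
  have h := (ZMod.natCast_eq_natCast_iff' i j n).1 hij
  rwa [Nat.mod_eq_of_lt (pos_and_lt_of_mem_jumps hn hi).2,
    Nat.mod_eq_of_lt (pos_and_lt_of_mem_jumps hn hj).2] at h

lemma neg_mem_jumpSet (hn : k + 2 ≤ n) (hkn : Even (k * n)) {s : ZMod n} (hs : s ∈ jumpSet k n) :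
    -s ∈ jumpSet k n := by
  obtain ⟨i, hi, rfl⟩ := hs
  have hlt := pos_and_lt_of_mem_jumps hn hi
  refine ⟨n - i, ?_, ?_⟩
  · rw [Finset.mem_coe, mem_jumps] at hi ⊢
    have := even_of_even_mul_of_not_even hkn
    by_cases hk : Even k
    · simp only [hk, not_true, false_and, or_false] at hi ⊢
      omega
    · have := this hk
      simp only [hk, not_false_eq_true, true_and] at hi ⊢
      omega
  · simp [Nat.cast_sub hlt.2.le]

lemma zero_notMem_jumpSet (hn : k + 2 ≤ n) : (0 : ZMod n) ∉ jumpSet k n := by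
  rintro ⟨i, hi, h⟩
  have hlt := pos_and_lt_of_mem_jumps hn hi
  exact absurd (Nat.le_of_dvd hlt.1 ((ZMod.natCast_eq_zero_iff i n).1 h)) (by omega)

lemma circulantGraph_jumpSet_adj (hn : k + 2 ≤ n) (hkn : Even (k * n)) {a b : ZMod n} :
    (SimpleGraph.circulantGraph (jumpSet k n)).Adj a b ↔ b - a ∈ jumpSet k n := by
  rw [SimpleGraph.circulantGraph_adj]
  constructor
  · rintro ⟨-, h | h⟩
    · simpa using neg_mem_jumpSet hn hkn h
    · exact h
  · intro h
    refine ⟨?_, .inr h⟩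
    rintro rfl
    exact zero_notMem_jumpSet hn (by simpa using h)

lemma exists_realizes (hk : 2 ≤ k) (hn : k + 2 ≤ n) (hkn : Even (k * n)) :
    ∃ p : ℕ × ℕ, Realizes k n p ∧ 0 < p.1 + p.2 := by
  have : NeZero n := ⟨by omega⟩
  set G := SimpleGraph.circulantGraph (jumpSet k n)
  have h1 : (1 : ZMod n) ∈ jumpSet k n :=
    ⟨1, by rw [Finset.mem_coe, mem_jumps]; omega, by simp⟩
  have hadj : ∀ a b : ZMod n, G.Adj a b ↔ b - a ∈ jumpSet k n :=
    fun a b ↦ circulantGraph_jumpSet_adj hn hkn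
  have hconn : G.Connected := by
    have hreach : ∀ i : ℕ, G.Reachable 0 (i : ZMod n) := by
      intro i
      induction i with
      | zero => simp
      | succ i ih => exact ih.trans (SimpleGraph.Adj.reachable ((hadj _ _).2 (by simpa using h1)))
    have hreach' : ∀ a : ZMod n, G.Reachable 0 a := fun a ↦ by
      simpa using hreach a.val
    exact ⟨fun a b ↦ (hreach' a).symm.trans (hreach' b)⟩
  refine ⟨((treesAvoiding G 0 1).ncard, (treesThrough G 0 1).ncard),
    ⟨ZMod n, inferInstance, G, 0, 1, Nat.card_zmod n, fun a ↦ ?_, ?_, rfl, rfl⟩, ?_⟩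
  · rw [← ncard_jumpSet hn hkn, ← Set.ncard_image_of_injective (jumpSet k n) (add_right_injective a)]
    congr 1
    ext b
    simp only [SimpleGraph.mem_neighborSet, hadj, Set.mem_image]
    exact ⟨fun h ↦ ⟨_, h, by simp⟩, by rintro ⟨c, hc, rfl⟩; simpa using hc⟩
  · exact (hadj _ _).2 (by simpa using h1)
  · have := ncard_treesThrough_pos hconn ((hadj 0 1).2 (by simpa using h1))
    simp only
    omega

end Circulant

section Counting

variable {a b : ℕ}

lemma seriesMap_injective (ha : 0 < a) : Function.Injective (seriesMap a b) := by
  rintro ⟨T, F⟩ ⟨T', F'⟩ h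
  simp only [seriesMap, Prod.mk.injEq] at h
  obtain ⟨h1, h2⟩ := h
  have hq : 0 < a + b := by omega
  obtain rfl := Nat.eq_of_mul_eq_mul_right hq h1
  obtain rfl : F = F' := Nat.eq_of_mul_eq_mul_right hq (by omega)
  rfl

lemma parallelMap_injective (hb : 0 < b) : Function.Injective (parallelMap a b) := by
  rintro ⟨T, F⟩ ⟨T', F'⟩ h
  simp only [parallelMap, Prod.mk.injEq] at h
  obtain ⟨h1, h2⟩ := h
  obtain rfl : T = T' := Nat.eq_of_mul_eq_mul_right (Nat.mul_pos hb hb) (by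
    zify at h1 h2 ⊢
    linear_combination b * h1 - a * h2)
  obtain rfl : F = F' := Nat.eq_of_mul_eq_mul_right hb (by omega)
  rfl

lemma seriesMap_iterate_fst_pos (ha : 0 < a) {p : ℕ × ℕ} (hp : 0 < p.1) (i : ℕ) :
    0 < ((seriesMap a b)^[i] p).1 := by
  induction i with
  | zero => exact hp
  | succ i ih =>
    rw [Function.iterate_succ_apply']
    exact Nat.mul_pos ih (by omega)

lemma mul_seriesMap_iterate_fst_le_snd (i : ℕ) (p : ℕ × ℕ) :
    i * ((seriesMap a b)^[i] p).1 ≤ ((seriesMap a b)^[i] p).2 := by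
  induction i with
  | zero => simp
  | succ i ih =>
    rw [Function.iterate_succ_apply']
    generalize (seriesMap a b)^[i] p = r at ih ⊢
    simp only [seriesMap]
    nlinarith [Nat.mul_le_mul_right (a + b) ih]

lemma parallelMap_fst_pos (ha : 0 < a) {p : ℕ × ℕ} (hp : 0 < p.1 + p.2) :
    0 < (parallelMap a b p).1 := by
  simp only [parallelMap]
  nlinarith [Nat.mul_pos ha hp]

lemma mul_parallelMap_snd_lt (hb : 0 < b) {p : ℕ × ℕ} (hp : 0 < p.1) :
    a * (parallelMap a b p).2 < b * (parallelMap a b p).1 := by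
  simp only [parallelMap]
  nlinarith [Nat.mul_pos (Nat.mul_pos hb hb) hp]

/-- If pairs of tree numbers may be transformed by `seriesMap` and `parallelMap` at the cost of
`M` vertices, then exponentially many pairs arise. -/
lemma exists_finset_card_eq_two_pow (ha : 0 < a) (hb : 0 < b) {M : ℕ} {R : ℕ → ℕ × ℕ → Prop}
    (hS : ∀ n p, R n p → R (n + M) (seriesMap a b p))
    (hP : ∀ n p, R n p → R (n + M) (parallelMap a b p))
    {n : ℕ} {p₀ : ℕ × ℕ} (h₀ : R n p₀) (hp₀ : 0 < p₀.1) (m : ℕ) :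
    ∃ s : Finset (ℕ × ℕ), s.card = 2 ^ m ∧ ∀ p ∈ s, R (n + m * (b * M)) p ∧ 0 < p.1 := by
  have hiter : ∀ (i l : ℕ) (p : ℕ × ℕ), R l p → R (l + i * M) ((seriesMap a b)^[i] p) := by
    intro i l p h
    induction i with
    | zero => simpa using h
    | succ i ih =>
      rw [Function.iterate_succ_apply', Nat.succ_mul, ← Nat.add_assoc]
      exact hS _ _ ih
  induction m with
  | zero => exact ⟨{p₀}, by simp, by simpa using ⟨h₀, hp₀⟩⟩
  | succ m ih =>
    obtain ⟨s, hs, hsR⟩ := ih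
    set f : ℕ × ℕ → ℕ × ℕ := (seriesMap a b)^[b]
    set g : ℕ × ℕ → ℕ × ℕ := fun p ↦ parallelMap a b ((seriesMap a b)^[b - 1] p)
    have hf : Function.Injective f := (seriesMap_injective ha).iterate b
    have hg : Function.Injective g :=
      (parallelMap_injective hb).comp ((seriesMap_injective ha).iterate (b - 1))
    have hdisj : Disjoint (s.image f) (s.image g) := by
      rw [Finset.disjoint_left]
      intro r hr hr'
      obtain ⟨p, -, rfl⟩ := Finset.mem_image.1 hr
      obtain ⟨p', hp', h⟩ := Finset.mem_image.1 hr'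
      have h1 := mul_parallelMap_snd_lt (a := a) hb
        (seriesMap_iterate_fst_pos (b := b) ha (hsR p' hp').2 (b - 1))
      change a * (g p').2 < b * (g p').1 at h1
      rw [h] at h1
      have h2 : b * (f p).1 ≤ (f p).2 := mul_seriesMap_iterate_fst_le_snd b p
      exact absurd (h2.trans (Nat.le_mul_of_pos_left _ ha)) (by omega)
    refine ⟨s.image f ∪ s.image g, ?_, fun r hr ↦ ?_⟩
    · rw [Finset.card_union_of_disjoint hdisj, Finset.card_image_of_injective _ hf,
        Finset.card_image_of_injective _ hg, hs]
      ring
    rw [Finset.mem_union, Finset.mem_image, Finset.mem_image] at hr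
    rw [Nat.succ_mul, ← Nat.add_assoc]
    rcases hr with ⟨p, hp, rfl⟩ | ⟨p, hp, rfl⟩
    · exact ⟨hiter _ _ _ (hsR p hp).1, seriesMap_iterate_fst_pos ha (hsR p hp).2 b⟩
    · have hpos := seriesMap_iterate_fst_pos (b := b) ha (hsR p hp).2 (b - 1)
      refine ⟨?_, parallelMap_fst_pos ha (by omega)⟩
      have h := hP _ _ (hiter (b - 1) _ _ (hsR p hp).1)
      rwa [Nat.add_assoc, ← Nat.succ_mul, Nat.succ_eq_add_one, Nat.sub_add_cancel hb] at h

/-- A pair of tree numbers is determined by the total numbers of trees after two series splices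
and after a parallel and a series splice. -/
lemma sum_series_sum_parallel_injective (ha : 0 < a) : Function.Injective fun p : ℕ × ℕ ↦
    ((seriesMap a b (seriesMap a b p)).1 + (seriesMap a b (seriesMap a b p)).2,
      (seriesMap a b (parallelMap a b p)).1 + (seriesMap a b (parallelMap a b p)).2) := by
  rintro ⟨T, F⟩ ⟨T', F'⟩ h
  simp only [seriesMap, parallelMap, Prod.mk.injEq] at h
  obtain ⟨h1, h2⟩ := h
  obtain rfl : T = T' := by
    have hpos : 0 < (a + b) * (2 * a * (a + 2 * b) ^ 2) := by positivity
    refine Nat.eq_of_mul_eq_mul_right hpos ?_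
    zify at h1 h2 ⊢
    linear_combination ((2 * a + 3 * b) * a + (a + b) * b : ℤ) * h1 - (a + b : ℤ) ^ 2 * h2
  obtain rfl : F = F' := by
    have hpos : 0 < (a + b) * (a + b) := by positivity
    refine Nat.eq_of_mul_eq_mul_right hpos ?_
    zify at h1 ⊢
    linear_combination h1
  rfl

end Counting

/-- The numbers of spanning trees of connected `k`-regular graphs on `n` vertices. -/
def treeSpectrum (k n : ℕ) : Set ℕ :=
  {m : ℕ | ∃ G : SimpleGraph (Fin n),
    G.Connected ∧ (∀ v : Fin n, (G.neighborSet v).ncard = k) ∧ numSpanningTrees G = m}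

lemma treeSpectrum_finite (k n : ℕ) : (treeSpectrum k n).Finite :=
  (Set.finite_range (numSpanningTrees (V := Fin n))).subset
    (by rintro _ ⟨G, -, -, rfl⟩; exact ⟨G, rfl⟩)

lemma exists_two_pow_le_ncard_treeSpectrum_sq {k : ℕ} (hk : 3 ≤ k) :
    ∃ b : ℕ, 0 < b ∧ ∀ n m : ℕ, k + 2 ≤ n → Even (k * n) →
      2 ^ m ≤ (treeSpectrum k (n + 3 * (2 * (k + 1)) + m * (b * (2 * (k + 1))))).ncard ^ 2 := by
  set M := 2 * (k + 1) with hM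
  have hcard : Nat.card (Fin (k + 1) ⊕ Fin (k + 1)) = M := by simp [hM, two_mul]
  have hQ := isGadget_gadget hk
  set a := (treesAvoiding (gadget k) (.inl 0) (.inr 0)).ncard
  set b := (treesThrough (gadget k) (.inl 0) (.inr 0)).ncard
  have hconn := gadget_deleteEdges_connected hk
  have ha : 0 < a := ncard_treesAvoiding_pos hconn
  have hb : 0 < b :=
    ncard_treesThrough_pos (hconn.mono (SimpleGraph.deleteEdges_le _)) hQ.adj
  have hS : ∀ n p, Realizes k n p → Realizes k (n + M) (seriesMap a b p) :=
    fun n p h ↦ hcard ▸ h.series hQ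
  have hP : ∀ n p, Realizes k n p → Realizes k (n + M) (parallelMap a b p) :=
    fun n p h ↦ hcard ▸ h.parallel hQ
  refine ⟨b, hb, fun n m hn hkn ↦ ?_⟩
  obtain ⟨p₀, h₀, hp₀⟩ := exists_realizes (by omega) hn hkn
  obtain ⟨s, hs, hsR⟩ := exists_finset_card_eq_two_pow ha hb hS hP (hP _ _ h₀)
    (parallelMap_fst_pos ha hp₀) m
  set N := n + 3 * M + m * (b * M)
  have hmem : ∀ p, Realizes k (n + M + m * (b * M) + M) p → 0 < p.1 →
      (seriesMap a b p).1 + (seriesMap a b p).2 ∈ treeSpectrum k N := by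
    intro p h hp
    have h' := hS _ _ h
    rw [show n + M + m * (b * M) + M + M = N by omega] at h'
    exact h'.exists_graph (Nat.add_pos_left (seriesMap_iterate_fst_pos ha hp 1) _)
  have hle := Set.ncard_le_ncard_of_injOn _ (s := (s : Set (ℕ × ℕ)))
    (t := treeSpectrum k N ×ˢ treeSpectrum k N) (fun p hp ↦ ?_)
    (sum_series_sum_parallel_injective (b := b) ha).injOn
    ((treeSpectrum_finite k N).prod (treeSpectrum_finite k N))
  · rwa [Set.ncard_coe_finset, hs, Set.ncard_prod, ← sq] at hle
  · obtain ⟨h, hp⟩ := hsR p hp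
    exact ⟨hmem _ (hS _ _ h) (seriesMap_iterate_fst_pos ha hp 1),
      hmem _ (hP _ _ h) (parallelMap_fst_pos ha (by omega))⟩

/-- For every fixed `k ≥ 3`, there are at least `2^(c n)` distinct values of `τ(G)` among
connected `k`-regular simple graphs `G` on `n` vertices, provided `k·n` is even. -/
theorem tree_spectrum_regular (k : ℕ) (hk : 3 ≤ k) :
    ∃ c : ℝ, 0 < c ∧ ∃ n₀ : ℕ, ∀ n : ℕ, n₀ ≤ n → Even (k * n) →
      (2 : ℝ) ^ (c * n) ≤
        (Set.ncard {m : ℕ | ∃ G : SimpleGraph (Fin n),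
          G.Connected ∧ (∀ v : Fin n, (G.neighborSet v).ncard = k) ∧
          numSpanningTrees G = m} : ℝ) := by
  obtain ⟨b, hb, h⟩ := exists_two_pow_le_ncard_treeSpectrum_sq hk
  set M := 2 * (k + 1) with hM
  have hD : 0 < b * M := by positivity
  refine ⟨1 / (4 * (b * M : ℕ)), by positivity, 2 * (k + 2 + 3 * M + b * M), fun n hn hkn ↦ ?_⟩
  set m := (n - (k + 2 + 3 * M)) / (b * M)
  have hm1 : m * (b * M) ≤ n - (k + 2 + 3 * M) := Nat.div_mul_le_self _ _
  have hm2 : n - (k + 2 + 3 * M) < (m + 1) * (b * M) := Nat.lt_mul_of_div_lt (Nat.lt_succ_self _) hD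
  rw [Nat.add_one_mul m] at hm2
  have hnm : n ≤ 2 * (m * (b * M)) := by omega
  have heven : Even (3 * M + m * (b * M)) := by
    rw [hM]
    exact ⟨3 * (k + 1) + m * (b * (k + 1)), by ring⟩
  have hsplit : n - (3 * M + m * (b * M)) + 3 * M + m * (b * M) = n := by omega
  have hle := h (n - (3 * M + m * (b * M))) m (by omega) (by
    rw [Nat.mul_sub, Nat.even_sub (Nat.mul_le_mul_left _ (by omega))]
    exact iff_of_true hkn (heven.mul_left k))
  rw [hsplit] at hle
  change _ ≤ ((treeSpectrum k n).ncard : ℝ)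
  have hexp : 1 / (4 * (b * M : ℕ)) * (n : ℝ) * (2 : ℕ) ≤ m := by
    have hD' : (0 : ℝ) < (b * M : ℕ) := by exact_mod_cast hD
    have hnm' : (n : ℝ) ≤ 2 * (m * (b * M : ℕ)) := by exact_mod_cast hnm
    rw [div_mul_eq_mul_div, div_mul_eq_mul_div, div_le_iff₀ (by positivity)]
    push_cast at hnm' ⊢
    linarith
  refine (pow_le_pow_iff_left₀ (by positivity) (by positivity) two_ne_zero).1 ?_
  calc ((2 : ℝ) ^ (1 / (4 * (b * M : ℕ)) * (n : ℝ))) ^ 2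
      = (2 : ℝ) ^ (1 / (4 * (b * M : ℕ)) * (n : ℝ) * (2 : ℕ)) :=
        (Real.rpow_mul_natCast zero_le_two _ _).symm
    _ ≤ (2 : ℝ) ^ (m : ℝ) := Real.rpow_le_rpow_of_exponent_le one_le_two hexp
    _ = ((2 ^ m : ℕ) : ℝ) := by rw [Real.rpow_natCast]; norm_cast
    _ ≤ ((treeSpectrum k n).ncard : ℝ) ^ 2 := by exact_mod_cast hle
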